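/- arXiv:1401.3264 — 8 statements merged into one kernel-verified Lean document; each statement's English description precedes it below -/
import Mathlib

section
/- Let R' = ℤ[D,K,H]/(D²−1, D·K−K, D·H−H, H²−4(1+D+K)). There exists a (necessarily unique) ring homomorphism ψ : R' → R' with ψ(D) = D, ψ(K) = K³−3K and ψ(H) = H·K−H. Moreover, setting A = K−(1+D) and B = H−2(1+D) in R', this homomorphism satisfies ψ(A) = A³+6A²+9A and ψ(B) = A·B+B+4A. -/
noncomputable section

open MvPolynomial

abbrev PDkh : Type := MvPolynomial (Fin 3) ℤ

/-- Relations `D² − 1`, `D·K − K`, `D·H − H`, `H² − 4(1 + D + K)` with `D, K, H = X 0, X 1, X 2`. -/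
def relsDKH : Set PDkh :=
  {X 0 ^ 2 - 1, X 0 * X 1 - X 1, X 0 * X 2 - X 2, X 2 ^ 2 - 4 * (1 + X 0 + X 1)}

/-- The ring `ℤ[D,K,H]/(D²−1, D·K−K, D·H−H, H²−4(1+D+K))`, i.e. `RO(Pin(2))`. -/
abbrev ROdkh : Type := PDkh ⧸ Ideal.span relsDKH

def Dv' : ROdkh := Ideal.Quotient.mk (Ideal.span relsDKH) (X 0)
def Kv' : ROdkh := Ideal.Quotient.mk (Ideal.span relsDKH) (X 1)
def Hv' : ROdkh := Ideal.Quotient.mk (Ideal.span relsDKH) (X 2)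

/-- The element `A = K − (1 + D)` of `R' = ℤ[D,K,H]/(…)`. -/
def Av' : ROdkh := Kv' - (1 + Dv')

/-- The element `B = H − 2(1 + D)` of `R' = ℤ[D,K,H]/(…)`. -/
def Bv' : ROdkh := Hv' - 2 * (1 + Dv')

theorem relsDKH_hold : Dv' ^ 2 = 1 ∧ Dv' * Kv' = Kv' ∧ Dv' * Hv' = Hv' ∧
    Hv' ^ 2 = 4 * (1 + Dv' + Kv') := by
  have key : ∀ p ∈ relsDKH, Ideal.Quotient.mk (Ideal.span relsDKH) p = 0 := fun p hp =>
    Ideal.Quotient.eq_zero_iff_mem.mpr (Ideal.subset_span hp)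
  refine ⟨?_, ?_, ?_, ?_⟩
  · have h := key (X 0 ^ 2 - 1) (by simp [relsDKH])
    simpa [Dv', sub_eq_zero] using h
  · have h := key (X 0 * X 1 - X 1) (by simp [relsDKH])
    rw [map_sub, map_mul] at h
    exact sub_eq_zero.mp h
  · have h := key (X 0 * X 2 - X 2) (by simp [relsDKH])
    rw [map_sub, map_mul] at h
    exact sub_eq_zero.mp h
  · have h := key (X 2 ^ 2 - 4 * (1 + X 0 + X 1)) (by simp [relsDKH])
    rw [map_sub, map_pow, map_mul, map_add, map_add, map_one, map_ofNat] at h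
    exact sub_eq_zero.mp h

/-- The polynomial identities behind the Adams operation, in any commutative ring. -/
theorem psi3_identities {R : Type*} [CommRing R] (D K H : R) (h1 : D ^ 2 = 1)
    (h2 : D * K = K) (h3 : D * H = H) (h4 : H ^ 2 = 4 * (1 + D + K)) :
    D * (K ^ 3 - 3 * K) = K ^ 3 - 3 * K ∧ D * (H * K - H) = H * K - H ∧
    (H * K - H) ^ 2 = 4 * (1 + D + (K ^ 3 - 3 * K)) ∧
    (K ^ 3 - 3 * K) - (1 + D) =
      (K - (1 + D)) ^ 3 + 6 * (K - (1 + D)) ^ 2 + 9 * (K - (1 + D)) ∧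
    (H * K - H) - 2 * (1 + D) =
      (K - (1 + D)) * (H - 2 * (1 + D)) + (H - 2 * (1 + D)) + 4 * (K - (1 + D)) := by
  refine ⟨?_, ?_, ?_, ?_, ?_⟩ <;> grind

/-- The evaluation homomorphism on the polynomial ring. -/
def psi3Pre : PDkh →+* ROdkh :=
  eval₂Hom (Int.castRingHom ROdkh) ![Dv', Kv' ^ 3 - 3 * Kv', Hv' * Kv' - Hv']

theorem psi3Pre_X0 : psi3Pre (X 0) = Dv' := by simp [psi3Pre]
theorem psi3Pre_X1 : psi3Pre (X 1) = Kv' ^ 3 - 3 * Kv' := by simp [psi3Pre]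
theorem psi3Pre_X2 : psi3Pre (X 2) = Hv' * Kv' - Hv' := by simp [psi3Pre]

theorem psi3Pre_zero : ∀ p ∈ Ideal.span relsDKH, psi3Pre p = 0 := by
  obtain ⟨h1, h2, h3, h4⟩ := relsDKH_hold
  obtain ⟨i1, i2, i3, -, -⟩ := psi3_identities _ _ _ h1 h2 h3 h4
  have hle : Ideal.span relsDKH ≤ RingHom.ker psi3Pre := by
    rw [Ideal.span_le]
    rintro p (rfl | rfl | rfl | rfl) <;>
      simp only [SetLike.mem_coe, RingHom.mem_ker, map_sub, map_mul, map_pow, map_add, map_one,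
        map_ofNat, psi3Pre_X0, psi3Pre_X1, psi3Pre_X2, sub_eq_zero] <;> assumption
  exact fun p hp => hle hp

/-- There exists a (necessarily unique) ring homomorphism `ψ : R' → R'` with
`ψ(D) = D`, `ψ(K) = K³ − 3K` and `ψ(H) = H·K − H`; moreover, with `A = K−(1+D)` and
`B = H−2(1+D)`, it satisfies `ψ(A) = A³ + 6A² + 9A` and `ψ(B) = A·B + B + 4A`. -/
theorem exists_unique_adams_psi3 :
    ∃! ψ : ROdkh →+* ROdkh,
      (ψ Dv' = Dv' ∧ ψ Kv' = Kv' ^ 3 - 3 * Kv' ∧ ψ Hv' = Hv' * Kv' - Hv') ∧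
      (ψ Av' = Av' ^ 3 + 6 * Av' ^ 2 + 9 * Av' ∧ ψ Bv' = Av' * Bv' + Bv' + 4 * Av') := by
  obtain ⟨h1, h2, h3, h4⟩ := relsDKH_hold
  obtain ⟨-, -, -, i4, i5⟩ := psi3_identities _ _ _ h1 h2 h3 h4
  let ψ : ROdkh →+* ROdkh := Ideal.Quotient.lift (Ideal.span relsDKH) psi3Pre psi3Pre_zero
  have e0 : ψ Dv' = Dv' := psi3Pre_X0
  have e1 : ψ Kv' = Kv' ^ 3 - 3 * Kv' := psi3Pre_X1
  have e2 : ψ Hv' = Hv' * Kv' - Hv' := psi3Pre_X2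
  refine ⟨ψ, ⟨⟨e0, e1, e2⟩, ?_, ?_⟩, ?_⟩
  · rw [Av', map_sub, map_add, map_one, e0, e1]
    exact i4
  · rw [Bv', Av', map_sub, map_mul, map_add, map_one, map_ofNat, e0, e2]
    exact i5
  · rintro φ ⟨⟨f0, f1, f2⟩, -⟩
    apply Ideal.Quotient.ringHom_ext
    apply MvPolynomial.ringHom_ext
    · intro r
      simp
    · intro i
      fin_cases i
      · exact f0.trans e0.symm
      · exact f1.trans e1.symm
      · exact f2.trans e2.symm
end
end

section
/- Every element x of R can be written uniquely in the form x = b·D + f(A) + B·g(A), i.e., there exist an integer b and polynomials f, g ∈ ℤ[t] with x = b·D + f(A) + B·g(A) in R, and if b·D + f(A) + B·g(A) = b'·D + f'(A) + B·g'(A) in R then b = b', f = f' and g = g'. -/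
noncomputable section

open MvPolynomial

abbrev PDab : Type := MvPolynomial (Fin 3) ℤ

/-- Relations `D² − 1`, `D·A − A`, `D·B − B`, `B² − 4(A − 2B)` with `D, A, B = X 0, X 1, X 2`. -/
def relsDAB : Set PDab :=
  {X 0 ^ 2 - 1, X 0 * X 1 - X 1, X 0 * X 2 - X 2, X 2 ^ 2 - 4 * (X 1 - 2 * X 2)}

/-- The ring `ℤ[D,A,B]/(D²−1, D·A−A, D·B−B, B²−4(A−2B))`, i.e. `RO(Pin(2))`. -/
abbrev RO : Type := PDab ⧸ Ideal.span relsDAB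

def Dv : RO := Ideal.Quotient.mk (Ideal.span relsDAB) (X 0)
def Av : RO := Ideal.Quotient.mk (Ideal.span relsDAB) (X 1)
def Bv : RO := Ideal.Quotient.mk (Ideal.span relsDAB) (X 2)

lemma rel_mem (p : PDab) (hp : p ∈ relsDAB) : Ideal.Quotient.mk (Ideal.span relsDAB) p = 0 :=
  Ideal.Quotient.eq_zero_iff_mem.mpr (Ideal.subset_span hp)

lemma relDD : Dv * Dv = 1 := by
  have h := rel_mem (X 0 ^ 2 - 1) (by simp [relsDAB])
  simp only [map_sub, map_pow, map_one] at h
  change Dv ^ 2 - 1 = 0 at h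
  linear_combination h

lemma relDA : Dv * Av = Av := by
  have h := rel_mem (X 0 * X 1 - X 1) (by simp [relsDAB])
  simp only [map_sub, map_mul] at h
  change Dv * Av - Av = 0 at h
  linear_combination h

lemma relDB : Dv * Bv = Bv := by
  have h := rel_mem (X 0 * X 2 - X 2) (by simp [relsDAB])
  simp only [map_sub, map_mul] at h
  change Dv * Bv - Bv = 0 at h
  linear_combination h

lemma relBB : Bv * Bv = 4 * Av - 8 * Bv := by
  have h := rel_mem (X 2 ^ 2 - 4 * (X 1 - 2 * X 2)) (by simp [relsDAB])
  simp only [map_sub, map_mul, map_pow, map_ofNat] at h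
  change Bv ^ 2 - 4 * (Av - 2 * Bv) = 0 at h
  linear_combination h

lemma exists_repr (x : RO) : ∃ (b : ℤ) (f g : Polynomial ℤ),
    x = (b : RO) * Dv + Polynomial.aeval Av f + Bv * Polynomial.aeval Av g := by
  obtain ⟨p, rfl⟩ := Ideal.Quotient.mk_surjective x
  induction p using MvPolynomial.induction_on with
  | C a =>
    refine ⟨0, Polynomial.C a, 0, ?_⟩
    simp
  | add p q hp hq =>
    obtain ⟨b, f, g, h⟩ := hp
    obtain ⟨b', f', g', h'⟩ := hq
    refine ⟨b + b', f + f', g + g', ?_⟩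
    rw [map_add, h, h']
    simp only [map_add, Int.cast_add]
    ring
  | mul_X p i hp =>
    obtain ⟨b, f, g, h⟩ := hp
    rw [map_mul, h]
    fin_cases i
    · change ∃ (b1 : ℤ) (f1 g1 : Polynomial ℤ), _ * Dv = (b1 : RO) * Dv + Polynomial.aeval Av f1 + Bv * Polynomial.aeval Av g1
      have hf : Polynomial.aeval Av f = Polynomial.aeval Av f.divX * Av + ((f.coeff 0 : ℤ) : RO) := by
        conv_lhs => rw [← Polynomial.divX_mul_X_add f]
        simp
      refine ⟨f.coeff 0, f.divX * Polynomial.X + Polynomial.C b, g, ?_⟩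
      rw [hf]
      simp only [map_add, map_mul, Polynomial.aeval_X, eq_intCast, map_intCast]
      linear_combination (b : RO) * relDD + Polynomial.aeval Av f.divX * relDA + Polynomial.aeval Av g * relDB
    · change ∃ (b1 : ℤ) (f1 g1 : Polynomial ℤ), _ * Av = (b1 : RO) * Dv + Polynomial.aeval Av f1 + Bv * Polynomial.aeval Av g1
      refine ⟨0, Polynomial.C b * Polynomial.X + f * Polynomial.X, g * Polynomial.X, ?_⟩
      simp only [map_add, map_mul, Polynomial.aeval_X, eq_intCast, map_intCast, Int.cast_zero]
      linear_combination (b : RO) * relDA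
    · change ∃ (b1 : ℤ) (f1 g1 : Polynomial ℤ), _ * Bv = (b1 : RO) * Dv + Polynomial.aeval Av f1 + Bv * Polynomial.aeval Av g1
      refine ⟨0, 4 * g * Polynomial.X, Polynomial.C b + f - 8 * g, ?_⟩
      simp only [map_add, map_sub, map_mul, map_ofNat, Polynomial.aeval_X, eq_intCast, map_intCast, Int.cast_zero]
      linear_combination (b : RO) * relDB + Polynomial.aeval Av g * relBB

/-- Evaluation at a solution of the relations. -/
lemma exists_hom {S : Type} [CommRing S] (d a c : S) (h1 : d ^ 2 - 1 = 0) (h2 : d * a - a = 0)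
    (h3 : d * c - c = 0) (h4 : c ^ 2 - 4 * (a - 2 * c) = 0) :
    ∃ φ : RO →+* S, φ Dv = d ∧ φ Av = a ∧ φ Bv = c := by
  refine ⟨Ideal.Quotient.lift _ (MvPolynomial.eval₂Hom (Int.castRingHom S) ![d, a, c]) ?_, ?_, ?_, ?_⟩
  · intro p hp
    rw [← RingHom.mem_ker]
    refine (Ideal.span_le.mpr ?_) hp
    intro q hq
    rw [SetLike.mem_coe, RingHom.mem_ker]
    rcases hq with rfl | rfl | rfl | rfl
    · simpa using h1
    · simpa using h2
    · simpa using h3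
    · simpa using h4
  · simp [Dv]
  · simp [Av]
  · simp [Bv]

lemma hom_aeval {S : Type} [CommRing S] (φ : RO →+* S) (f : Polynomial ℤ) :
    φ (Polynomial.aeval Av f) = Polynomial.aeval (φ Av) f :=
  (Polynomial.aeval_algHom_apply φ.toIntAlgHom Av f).symm

lemma repr_zero (b : ℤ) (f g : Polynomial ℤ)
    (h : (b : RO) * Dv + Polynomial.aeval Av f + Bv * Polynomial.aeval Av g = 0) :
    b = 0 ∧ f = 0 ∧ g = 0 := by
  obtain ⟨φ, hD, hA, hB⟩ := exists_hom (S := ℤ) (-1) 0 0 (by simp) (by simp) (by simp) (by simp)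
  obtain ⟨χ, hD', hA', hB'⟩ := exists_hom (S := ℤ) 1 0 0 (by simp) (by simp) (by simp) (by simp)
  obtain ⟨ψ, hD2, hA2, hB2⟩ := exists_hom (S := Polynomial ℤ) 1
    (Polynomial.X ^ 2 + 4 * Polynomial.X) (2 * Polynomial.X)
    (by ring) (by ring) (by ring) (by ring)
  have e1 := congrArg φ h
  have e2 := congrArg χ h
  have e3 := congrArg ψ h
  simp only [map_add, map_mul, hom_aeval, hD, hA, hB, hD', hA', hB', map_intCast, map_zero] at e1 e2
  simp only [map_add, map_mul, hom_aeval, hD2, hA2, hB2, map_intCast, map_zero] at e3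
  have hb : b = 0 := by
    simp only [Int.cast_id] at e1 e2
    linarith
  subst hb
  set P : Polynomial ℤ := Polynomial.X ^ 2 + 4 * Polynomial.X with hP
  have hdeg : P.natDegree = 2 := by
    rw [hP]
    compute_degree!
  have inj : ∀ q : Polynomial ℤ, q.comp P = 0 → q = 0 := by
    intro q hq
    rcases Polynomial.comp_eq_zero_iff.mp hq with h | ⟨_, h⟩
    · exact h
    · rw [h, Polynomial.natDegree_C] at hdeg
      omega
  have e4 : f.comp P + 2 * Polynomial.X * g.comp P = 0 := by
    have hC : Int.castRingHom (Polynomial ℤ) = Polynomial.C := RingHom.ext_int _ _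
    simpa [Polynomial.aeval_def, Polynomial.comp, hC] using e3
  have hPs : P.comp (-4 - Polynomial.X) = P := by
    rw [hP]
    simp
    ring
  have e5 := congrArg (fun q => Polynomial.comp q (-4 - Polynomial.X)) e4
  simp only [Polynomial.add_comp, Polynomial.mul_comp, Polynomial.comp_assoc, hPs,
    Polynomial.X_comp, Polynomial.zero_comp, Polynomial.ofNat_comp] at e5
  have e6 : (4 * Polynomial.X + 8 : Polynomial ℤ) * g.comp P = 0 := by
    linear_combination e4 - e5
  have hne : (4 * Polynomial.X + 8 : Polynomial ℤ) ≠ 0 := by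
    intro h0
    have := congrArg (Polynomial.eval 0) h0
    simp at this
  have hg0 := (mul_eq_zero.mp e6).resolve_left hne
  rw [hg0] at e4
  exact ⟨rfl, inj f (by simpa using e4), inj g hg0⟩

/-- Lemma 7.4(1). Every element `x` of `R = ℤ[D,A,B]/(…)` can be written
uniquely as `x = b·D + f(A) + B·g(A)` with `b ∈ ℤ` and `f, g ∈ ℤ[t]`. -/
theorem unique_repr_D_A_B :
    (∀ x : RO, ∃ (b : ℤ) (f g : Polynomial ℤ),
      x = (b : RO) * Dv + Polynomial.aeval Av f + Bv * Polynomial.aeval Av g) ∧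
    (∀ (b b' : ℤ) (f f' g g' : Polynomial ℤ),
      (b : RO) * Dv + Polynomial.aeval Av f + Bv * Polynomial.aeval Av g =
        (b' : RO) * Dv + Polynomial.aeval Av f' + Bv * Polynomial.aeval Av g' →
      b = b' ∧ f = f' ∧ g = g') := by
  refine ⟨exists_repr, ?_⟩
  intro b b' f f' g g' h
  have := repr_zero (b - b') (f - f') (g - g') (by
    simp only [map_sub, Int.cast_sub]
    linear_combination h)
  exact ⟨sub_eq_zero.mp this.1, sub_eq_zero.mp this.2.1, sub_eq_zero.mp this.2.2⟩
end
end

section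
/- Let l ≥ 0 be an integer and let h ∈ ℤ[s,t] be a polynomial in two variables. If (A−2B)^l · h(A,B) = 0 in R, then h(A,B) = 0 in R. In other words, multiplication by (A−2B)^l is injective on the subring of R generated by A and B. -/
noncomputable section

open MvPolynomial

/-- The map `R → ℤ[x]`, `D ↦ 1`, `A ↦ x² + 4x`, `B ↦ 2x`. -/
def phiRO : RO →+* Polynomial ℤ :=
  Ideal.Quotient.lift (Ideal.span relsDAB)
    (MvPolynomial.aeval (R := ℤ)
      ![(1 : Polynomial ℤ), Polynomial.X ^ 2 + 4 * Polynomial.X, 2 * Polynomial.X]).toRingHom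
    (by
      intro a ha
      have : Ideal.span relsDAB ≤ RingHom.ker (MvPolynomial.aeval (R := ℤ)
          ![(1 : Polynomial ℤ), Polynomial.X ^ 2 + 4 * Polynomial.X,
            2 * Polynomial.X]).toRingHom := by
        rw [Ideal.span_le]
        intro r hr
        simp only [relsDAB, Set.mem_insert_iff, Set.mem_singleton_iff] at hr
        rw [SetLike.mem_coe, RingHom.mem_ker]
        rcases hr with rfl | rfl | rfl | rfl <;> simp
        ring
      exact this ha)

theorem phiRO_A : phiRO Av = Polynomial.X ^ 2 + 4 * Polynomial.X := by
  simp [phiRO, Av]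

theorem phiRO_B : phiRO Bv = 2 * Polynomial.X := by
  simp [phiRO, Bv]

theorem B_sq : Bv * Bv = 4 * (Av - 2 * Bv) := by
  have h : Ideal.Quotient.mk (Ideal.span relsDAB)
      (X 2 ^ 2 - 4 * (X 1 - 2 * X 2)) = 0 := by
    rw [Ideal.Quotient.eq_zero_iff_mem]
    exact Ideal.subset_span (by simp [relsDAB])
  simp only [map_sub, map_mul, map_pow, map_ofNat] at h
  change Bv ^ 2 - 4 * (Av - 2 * Bv) = 0 at h
  linear_combination h

theorem normal_form (h : MvPolynomial (Fin 2) ℤ) : ∃ p q : Polynomial ℤ,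
    MvPolynomial.aeval ![Av, Bv] h =
      Polynomial.aeval (Av - 2 * Bv) p + Bv * Polynomial.aeval (Av - 2 * Bv) q := by
  induction h using MvPolynomial.induction_on with
  | C a => exact ⟨Polynomial.C a, 0, by simp⟩
  | add f g hf hg =>
    obtain ⟨p, q, h1⟩ := hf
    obtain ⟨p', q', h2⟩ := hg
    exact ⟨p + p', q + q', by simp only [map_add, h1, h2]; ring⟩
  | mul_X f i hf =>
    obtain ⟨p, q, h1⟩ := hf
    have hB := B_sq
    fin_cases i
    · refine ⟨Polynomial.X * p + 8 * Polynomial.X * q, Polynomial.X * q + 2 * p, ?_⟩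
      simp only [map_mul, h1, map_add, Polynomial.aeval_X, MvPolynomial.aeval_X, map_ofNat]
      simp only [Fin.zero_eta, Matrix.cons_val_zero]
      linear_combination (2 * Polynomial.aeval (Av - 2 * Bv) q) * hB
    · refine ⟨4 * Polynomial.X * q, p, ?_⟩
      simp only [map_mul, h1, Polynomial.aeval_X, MvPolynomial.aeval_X, map_ofNat]
      simp only [Fin.mk_one, Matrix.cons_val_one, Matrix.cons_val_fin_one]
      linear_combination (Polynomial.aeval (Av - 2 * Bv) q) * hB

theorem phiRO_C : phiRO (Av - 2 * Bv) = Polynomial.X ^ 2 := by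
  rw [map_sub, map_mul, phiRO_A, phiRO_B, map_ofNat]; ring

theorem phiRO_aeval (p : Polynomial ℤ) :
    phiRO (Polynomial.aeval (Av - 2 * Bv) p) = Polynomial.expand ℤ 2 p := by
  rw [Polynomial.expand_eq_sum, Polynomial.aeval_eq_sum_range, map_sum,
    Polynomial.sum_over_range _ (by simp)]
  refine Finset.sum_congr rfl fun i _ => ?_
  rw [map_zsmul, map_pow, phiRO_C, zsmul_eq_mul]
  simp

theorem parity (p q : Polynomial ℤ)
    (h : Polynomial.expand ℤ 2 p + 2 * Polynomial.X * Polynomial.expand ℤ 2 q = 0) :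
    p = 0 ∧ q = 0 := by
  have e : Polynomial.expand ℤ 2 p +
      Polynomial.C 2 * (Polynomial.expand ℤ 2 q * Polynomial.X) = 0 := by
    rw [← h]; simp; ring
  have hq : q = 0 := by
    ext n
    have := congrArg (fun r => Polynomial.coeff r (2 * n + 1)) e
    simp only [Polynomial.coeff_add, Polynomial.coeff_C_mul, Polynomial.coeff_mul_X,
      Polynomial.coeff_expand (show 0 < 2 by norm_num), Polynomial.coeff_zero] at this
    rw [if_neg (by omega), if_pos (by omega), Nat.mul_div_cancel_left _ (by norm_num)] at this
    simpa using this
  subst hq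
  refine ⟨?_, rfl⟩
  simpa [Polynomial.expand_eq_zero] using h

/-- Lemma 7.4(6). If `(A − 2B)^l · h(A,B) = 0` in `R` for a two-variable
integer polynomial `h`, then `h(A,B) = 0` in `R`. -/
theorem pow_A_sub_two_B_mul_eq_zero (l : ℕ) (h : MvPolynomial (Fin 2) ℤ)
    (hyp : (Av - 2 * Bv) ^ l * MvPolynomial.aeval ![Av, Bv] h = 0) :
    MvPolynomial.aeval ![Av, Bv] h = 0 := by
  obtain ⟨p, q, hn⟩ := normal_form h
  have h0 := congrArg phiRO hyp
  rw [map_mul, map_pow, phiRO_C, map_zero, hn, map_add, map_mul, phiRO_aeval, phiRO_aeval,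
    phiRO_B] at h0
  have h1 := (mul_eq_zero.mp h0).resolve_left
    (pow_ne_zero _ (pow_ne_zero _ Polynomial.X_ne_zero))
  obtain ⟨rfl, rfl⟩ := parity p q h1
  rw [hn]; simp
end
end

section
/- Let f ∈ ℤ[t] be a polynomial and let h ∈ ℤ[s,t] be a polynomial in two variables with zero constant term. If f(D) = h(A,B) in R, then h(A,B) = 0 in R (and hence f(D) = 0 in R). -/
noncomputable section

open MvPolynomial

/-- Lemma 7.4(7). If `f(D) = h(A,B)` in `R` for some polynomial `f ∈ ℤ[t]`
and some two-variable polynomial `h ∈ ℤ[s,t]` with zero constant term, then `h(A,B) = 0`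
(and hence `f(D) = 0`) in `R`. -/
theorem eval_D_eq_eval_AB_imp_zero (f : Polynomial ℤ) (h : MvPolynomial (Fin 2) ℤ)
    (hconst : MvPolynomial.coeff 0 h = 0)
    (hyp : Polynomial.aeval Dv f = MvPolynomial.aeval ![Av, Bv] h) :
    MvPolynomial.aeval ![Av, Bv] h = 0 ∧ Polynomial.aeval Dv f = 0 := by
  have key : ∀ d : ℤ, d ^ 2 = 1 → f.eval d = 0 := by
    intro d hd
    let g : PDab →ₐ[ℤ] ℤ := MvPolynomial.aeval ![d, 0, 0]
    have hg : ∀ a ∈ Ideal.span relsDAB, g a = 0 := by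
      intro a ha
      have hle : Ideal.span relsDAB ≤ RingHom.ker g := by
        rw [Ideal.span_le]
        intro x hx
        simp only [relsDAB, Set.mem_insert_iff, Set.mem_singleton_iff] at hx
        rcases hx with rfl | rfl | rfl | rfl <;>
          simp [g, RingHom.mem_ker, hd]
      exact hle ha
    let φ : RO →ₐ[ℤ] ℤ := Ideal.Quotient.liftₐ (Ideal.span relsDAB) g hg
    have hD : φ Dv = d := by
      change g (X 0) = d
      simp [g]
    have hA : φ Av = 0 := by
      change g (X 1) = 0
      simp [g]
    have hB : φ Bv = 0 := by
      change g (X 2) = 0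
      simp [g]
    have h1 := congrArg φ hyp
    rw [← Polynomial.aeval_algHom_apply, hD, MvPolynomial.comp_aeval_apply] at h1
    have h2 : (fun i => φ (![Av, Bv] i)) = (0 : Fin 2 → ℤ) := by
      funext i
      fin_cases i
      · exact hA
      · exact hB
    rw [h2, MvPolynomial.aeval_zero, MvPolynomial.constantCoeff_eq, hconst] at h1
    simpa [Polynomial.aeval_def] using h1
  have hDD : Dv ^ 2 = 1 := by
    have : Ideal.Quotient.mk (Ideal.span relsDAB) (X 0 ^ 2 - 1) = 0 :=
      Ideal.Quotient.eq_zero_iff_mem.mpr (Ideal.subset_span (by simp [relsDAB]))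
    rw [map_sub, map_pow, map_one] at this
    exact sub_eq_zero.mp this
  have hf : Polynomial.aeval Dv f = 0 := by
    obtain ⟨q, hq⟩ := Polynomial.dvd_iff_isRoot.mpr (key 1 (by norm_num))
    have h3 := key (-1) (by norm_num)
    rw [hq] at h3
    have h4 : q.eval (-1) = 0 := by
      simpa using h3
    obtain ⟨r, hr⟩ := Polynomial.dvd_iff_isRoot.mpr h4
    rw [hq, hr, ← mul_assoc, map_mul]
    have : Polynomial.aeval Dv ((Polynomial.X - Polynomial.C (1:ℤ)) * (Polynomial.X - Polynomial.C (-1:ℤ))) = 0 := by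
      simp
      linear_combination hDD
    rw [this, zero_mul]
  exact ⟨hyp ▸ hf, hf⟩
end
end

section
/- Let l ≥ 0 be an integer and let a ∈ ℤ. If a·(1−D) belongs to the ideal of R generated by the two elements (2+A−2D−2B)^l·(2−2D−B) and (A−2B)^l·(B−A), then 2^{2l+2} divides a (equivalently, 2^{2l+3} divides φ₀(a·(1−D)) = 2a, where φ₀ : R → ℤ is the unique ring homomorphism with φ₀(D) = −1 and φ₀(A) = φ₀(B) = 0). -/
noncomputable section

open MvPolynomial

/-- The ring homomorphism `RO → ℤ` attached to an integer solution `v` of the relations. -/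
def evRO (v : Fin 3 → ℤ) (h0 : v 0 ^ 2 - 1 = 0) (h1 : v 0 * v 1 - v 1 = 0)
    (h2 : v 0 * v 2 - v 2 = 0) (h3 : v 2 ^ 2 - 4 * (v 1 - 2 * v 2) = 0) : RO →+* ℤ :=
  Ideal.Quotient.lift (Ideal.span relsDAB) (MvPolynomial.eval v) (by
    intro x hx
    have hle : Ideal.span relsDAB ≤ RingHom.ker (MvPolynomial.eval v) := by
      rw [Ideal.span_le]
      intro y hy
      simp only [relsDAB, Set.mem_insert_iff, Set.mem_singleton_iff] at hy
      rw [SetLike.mem_coe, RingHom.mem_ker]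
      rcases hy with rfl | rfl | rfl | rfl <;> simp <;> assumption
    exact hle hx)

theorem evRO_mk (v : Fin 3 → ℤ) (h0 h1 h2 h3) (x : PDab) :
    evRO v h0 h1 h2 h3 (Ideal.Quotient.mk _ x) = MvPolynomial.eval v x :=
  Ideal.Quotient.lift_mk _ _ _

/-- Integer points that agree modulo `2` give evaluations that agree modulo `2`. -/
theorem eval_parity (v w : Fin 3 → ℤ) (h : ∀ i, (2 : ℤ) ∣ v i - w i) (x : PDab) :
    (2 : ℤ) ∣ MvPolynomial.eval v x - MvPolynomial.eval w x := by
  induction x using MvPolynomial.induction_on with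
  | C c => simp
  | add p q hp hq =>
    have := dvd_add hp hq
    simp only [map_add]
    obtain ⟨c, hc⟩ := this
    exact ⟨c, by linarith⟩
  | mul_X p i hp =>
    simp only [map_mul, eval_X]
    have := dvd_add (hp.mul_right (v i)) ((h i).mul_left (MvPolynomial.eval w p))
    obtain ⟨c, hc⟩ := this
    exact ⟨c, by linarith⟩

/-- Lemma 7.6. If `a·(1−D)` lies in the ideal of `R` generated by
`(2+A−2D−2B)^l·(2−2D−B)` and `(A−2B)^l·(B−A)`, then `2^{2l+2} ∣ a`. -/
theorem lemma_7_6 (l : ℕ) (a : ℤ)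
    (hyp : (a : RO) * (1 - Dv) ∈ Ideal.span
      {(2 + Av - 2 * Dv - 2 * Bv) ^ l * (2 - 2 * Dv - Bv),
       (Av - 2 * Bv) ^ l * (Bv - Av)}) :
    (2 : ℤ) ^ (2 * l + 2) ∣ a := by
  obtain ⟨p, q, hpq⟩ := Ideal.mem_span_pair.1 hyp
  obtain ⟨p, rfl⟩ := Ideal.Quotient.mk_surjective p
  obtain ⟨q, rfl⟩ := Ideal.Quotient.mk_surjective q
  -- the point `D = -1, A = B = 0`
  have e0 := congrArg (evRO ![-1, 0, 0] (by simp) (by simp) (by simp) (by simp)) hpq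
  -- the point `D = 1, A = 12, B = 4`
  have e1 := congrArg (evRO ![1, 12, 4] (by simp) (by simp) (by simp) (by simp)) hpq
  have hpar := eval_parity ![-1, 0, 0] ![1, 12, 4]
    (by intro i; fin_cases i <;> simp <;> norm_num) p
  simp only [map_add, map_mul, map_sub, map_pow, map_one, map_ofNat, map_intCast, Dv, Av, Bv,
    evRO_mk, eval_X] at e0 e1
  generalize MvPolynomial.eval ![-1, 0, 0] p = P at *
  generalize MvPolynomial.eval ![1, 12, 4] p = P' at *
  generalize MvPolynomial.eval ![1, 12, 4] q = Q' at *
  have b0 : (![-1, 0, 0] : Fin 3 → ℤ) 2 = 0 := rfl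
  have b1 : (![1, 12, 4] : Fin 3 → ℤ) 2 = 4 := rfl
  rw [b0] at e0
  rw [b1] at e1
  norm_num at e0 e1
  have h4 : (4 : ℤ) ^ l ≠ 0 := by positivity
  have e2 : P' = -2 * Q' := by
    apply mul_left_cancel₀ h4
    linarith
  obtain ⟨k, hk⟩ := hpar
  refine ⟨k - Q', ?_⟩
  have hP : P = 2 * (k - Q') := by linarith
  have h2 : (2 : ℤ) ^ (2 * l + 2) = 4 ^ l * 4 := by
    rw [pow_add, pow_mul]; norm_num
  rw [h2]
  subst hP
  linarith
end
end

section
/- Let f₁, g₁, f₂, g₂ ∈ ℤ[t] be polynomials. If −B·(f₁(A) + B·g₁(A)) + (B−A)·(f₂(A) + B·g₂(A)) = 0 in R, then f₂ = 4·(g₂ − g₁) as polynomials (in particular 4 divides every coefficient of f₂) and 8 divides f₁(0) − f₂(0) (in particular 4 divides f₁(0)). -/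
noncomputable section

open MvPolynomial

abbrev QA : Type := QuadraticAlgebra (Polynomial ℤ) (4 * Polynomial.X) (-8)

def qpt : Fin 3 → QA := ![1, QuadraticAlgebra.C Polynomial.X, ⟨0, 1⟩]

def toQA : RO →+* QA :=
  Ideal.Quotient.lift (Ideal.span relsDAB) (MvPolynomial.eval₂Hom (Int.castRingHom QA) qpt) (by
    intro a ha
    have h : Ideal.span relsDAB ≤ RingHom.ker (MvPolynomial.eval₂Hom (Int.castRingHom QA) qpt) := by
      rw [Ideal.span_le]
      intro x hx
      simp only [relsDAB, Set.mem_insert_iff, Set.mem_singleton_iff] at hx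
      rw [SetLike.mem_coe, RingHom.mem_ker]
      rcases hx with rfl | rfl | rfl | rfl
      · simp [qpt]
      · simp [qpt]
      · simp [qpt]
      · have e4 : (4 : QA) = ⟨4, 0⟩ := rfl
        have e2 : (2 : QA) = ⟨2, 0⟩ := rfl
        simp only [map_sub, map_mul, map_pow, map_ofNat, MvPolynomial.coe_eval₂Hom,
          MvPolynomial.eval₂_X, qpt, e4, e2]
        ext1 <;> simp [pow_two] <;> ring
    exact h ha)

theorem toQA_A : toQA Av = QuadraticAlgebra.C Polynomial.X := by
  simp [toQA, Av, qpt]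

theorem toQA_B : toQA Bv = ⟨0, 1⟩ := by
  simp [toQA, Bv, qpt]

theorem toQA_aeval (f : Polynomial ℤ) :
    toQA (Polynomial.aeval Av f) = QuadraticAlgebra.C f := by
  induction f using Polynomial.induction_on' with
  | add p q hp hq => simp [hp, hq]
  | monomial n a =>
    rw [← Polynomial.C_mul_X_pow_eq_monomial]
    simp [toQA_A]

/-- analysis of equation (38) in the proof of Lemma 7.6. If
`−B·(f₁(A) + B·g₁(A)) + (B−A)·(f₂(A) + B·g₂(A)) = 0` in `R`, then `f₂ = 4·(g₂ − g₁)` as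
polynomials, and `8` divides `f₁(0) − f₂(0)`. -/
theorem eq_38_analysis (f₁ g₁ f₂ g₂ : Polynomial ℤ)
    (hyp : -Bv * (Polynomial.aeval Av f₁ + Bv * Polynomial.aeval Av g₁) +
      (Bv - Av) * (Polynomial.aeval Av f₂ + Bv * Polynomial.aeval Av g₂) = 0) :
    f₂ = 4 * (g₂ - g₁) ∧ (8 : ℤ) ∣ (f₁.coeff 0 - f₂.coeff 0) := by
  have h := congrArg toQA hyp
  simp only [map_add, map_mul, map_neg, map_sub, map_zero, toQA_A, toQA_B, toQA_aeval] at h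
  have h1 := congrArg QuadraticAlgebra.re h
  have h2 := congrArg QuadraticAlgebra.im h
  simp at h1 h2
  have h3 : f₂ = 4 * (g₂ - g₁) := by
    have : Polynomial.X * (f₂ - 4 * (g₂ - g₁)) = 0 := by linear_combination -h1
    rcases mul_eq_zero.1 this with h | h
    · exact absurd h Polynomial.X_ne_zero
    · exact sub_eq_zero.1 h
  refine ⟨h3, ?_⟩
  have h4 : f₁ - f₂ = Polynomial.C 8 * (g₁ - g₂) - Polynomial.X * g₂ := by
    have : (Polynomial.C 8 : Polynomial ℤ) = 8 := rfl
    rw [this]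
    linear_combination -h2
  have h5 := congrArg (fun p => Polynomial.coeff p 0) h4
  simp only [Polynomial.coeff_sub, Polynomial.coeff_C_zero, Polynomial.mul_coeff_zero,
    Polynomial.coeff_X_zero, zero_mul, sub_zero] at h5
  exact ⟨_, h5⟩
end
end

section
/- Let k ≥ 0 and l ≥ 1 be integers, let p ∈ ℤ, and let h ∈ ℤ[t] be a polynomial each of whose coefficients is either 0 or 1. Define g(t) = (t+1)^{2k}·(p + t·h(t)) − (t+1)^{2k+4l}·(p + (t³+t)·h(t³+t)) ∈ ℤ[t]. If the constant coefficient of g is 0 and every coefficient of g in positive degree is even, then h = 0 and p is even. -/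
open Polynomial

/-- the Claim in the proof of Proposition 3.1. Let `k ≥ 0`, `l ≥ 1`,
`p ∈ ℤ`, and let `h ∈ ℤ[t]` have all coefficients `0` or `1`. Set
`g(t) = (t+1)^{2k}·(p + t·h(t)) − (t+1)^{2k+4l}·(p + (t³+t)·h(t³+t))`.
If the constant coefficient of `g` is `0` and every positive-degree coefficient of `g` is
even, then `h = 0` and `p` is even. -/
theorem claim_prop_3_1 (k l : ℕ) (hl : 1 ≤ l) (p : ℤ) (h : Polynomial ℤ)
    (hcoeff : ∀ i, h.coeff i = 0 ∨ h.coeff i = 1)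
    (g : Polynomial ℤ)
    (hg : g = (X + 1) ^ (2 * k) * (C p + X * h) -
      (X + 1) ^ (2 * k + 4 * l) * (C p + (X ^ 3 + X) * h.comp (X ^ 3 + X)))
    (hg0 : g.coeff 0 = 0) (hgpos : ∀ i, 0 < i → (2 : ℤ) ∣ g.coeff i) :
    h = 0 ∧ (2 : ℤ) ∣ p := by
  set φ := Int.castRingHom (ZMod 2) with hφ
  have hgm : g.map φ = 0 := by
    ext i
    rw [coeff_map, coeff_zero]
    have h2 : (2 : ℤ) ∣ g.coeff i := by
      rcases Nat.eq_zero_or_pos i with rfl | hi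
      · rw [hg0]; exact dvd_zero _
      · exact hgpos i hi
    simpa using (ZMod.intCast_zmod_eq_zero_iff_dvd (g.coeff i) 2).2 (by exact_mod_cast h2)
  set f : Polynomial (ZMod 2) := C (φ p) + X * h.map φ with hf
  have hX1 : (X + 1 : Polynomial (ZMod 2)).Monic := by
    simpa using monic_X_add_C (1 : ZMod 2)
  have hd1 : (X + 1 : Polynomial (ZMod 2)).natDegree = 1 := by
    simpa using natDegree_X_add_C (1 : ZMod 2)
  have hd3 : (X ^ 3 + X : Polynomial (ZMod 2)).natDegree = 3 := by compute_degree!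
  have key : (X + 1) ^ (2 * k) * f = (X + 1) ^ (2 * k) * ((X + 1) ^ (4 * l) * f.comp (X ^ 3 + X)) := by
    rw [hg] at hgm
    simp only [Polynomial.map_sub, Polynomial.map_mul, Polynomial.map_pow, Polynomial.map_add,
      map_X, map_C, Polynomial.map_one, Polynomial.map_comp] at hgm
    rw [sub_eq_zero] at hgm
    rw [hf, hgm, pow_add]
    simp only [add_comp, C_comp, mul_comp, X_comp]
    ring
  have key2 := mul_left_cancel₀ (pow_ne_zero _ hX1.ne_zero) key
  have hf0 : f = 0 := by
    by_contra hne
    have hc : f.comp (X ^ 3 + X) ≠ 0 := by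
      intro h0
      rw [h0, mul_zero] at key2
      exact hne key2
    have := congrArg natDegree key2
    rw [natDegree_mul (pow_ne_zero _ hX1.ne_zero) hc, natDegree_pow, hd1, natDegree_comp, hd3] at this
    omega
  constructor
  · ext i
    have hi := congrArg (fun q => coeff q (i + 1)) hf0
    simp only [hf, coeff_add, coeff_X_mul, coeff_map, coeff_C_succ, zero_add, coeff_zero] at hi
    rcases hcoeff i with h0 | h1
    · simpa using h0
    · rw [h1] at hi
      simp at hi
  · have hi := congrArg (fun q => coeff q 0) hf0
    simp [hf] at hi
    exact_mod_cast (ZMod.intCast_zmod_eq_zero_iff_dvd p 2).1 (by simpa [hφ] using hi)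
end

section
/- The assignment D ↦ 1, B ↦ x, A ↦ x²/4 + 2x extends to a well-defined ring homomorphism from R to the polynomial ring ℚ[x], and moreover for all polynomials f, g ∈ ℚ[x], if f(x²/4 + 2x) + x·g(x²/4 + 2x) = 0 in ℚ[x] then f = 0 and g = 0. -/
noncomputable section

open MvPolynomial

/-- the homomorphism `ψ` in the proof of Lemma 7.4(6). The assignment
`D ↦ 1`, `B ↦ x`, `A ↦ x²/4 + 2x` extends to a ring homomorphism `R → ℚ[x]`, and for all
`f, g ∈ ℚ[x]`, if `f(x²/4+2x) + x·g(x²/4+2x) = 0` then `f = 0` and `g = 0`. -/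
theorem psi_to_rat_poly :
    (∃ φ : RO →+* Polynomial ℚ,
      φ Dv = 1 ∧ φ Bv = Polynomial.X ∧
      φ Av = Polynomial.C (1 / 4 : ℚ) * Polynomial.X ^ 2 + 2 * Polynomial.X) ∧
    (∀ f g : Polynomial ℚ,
      f.comp (Polynomial.C (1 / 4 : ℚ) * Polynomial.X ^ 2 + 2 * Polynomial.X) +
        Polynomial.X *
          g.comp (Polynomial.C (1 / 4 : ℚ) * Polynomial.X ^ 2 + 2 * Polynomial.X) = 0 →
      f = 0 ∧ g = 0) := by
  constructor
  · let e : PDab →+* Polynomial ℚ := MvPolynomial.eval₂Hom (Int.castRingHom (Polynomial ℚ))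
      ![1, Polynomial.C (1 / 4 : ℚ) * Polynomial.X ^ 2 + 2 * Polynomial.X, Polynomial.X]
    have e0 : e (X 0) = 1 := by simp [e]
    have e1 : e (X 1) =
        Polynomial.C (1 / 4 : ℚ) * Polynomial.X ^ 2 + 2 * Polynomial.X := by simp [e]
    have e2 : e (X 2) = Polynomial.X := by simp [e]
    have h4 : (4 : Polynomial ℚ) * Polynomial.C (1 / 4 : ℚ) = 1 := by
      have : (4 : Polynomial ℚ) = Polynomial.C 4 := rfl
      rw [this, ← Polynomial.C_mul]
      norm_num
    have hle : Ideal.span relsDAB ≤ RingHom.ker e := by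
      rw [Ideal.span_le]
      rintro p (rfl | rfl | rfl | rfl) <;>
        simp only [SetLike.mem_coe, RingHom.mem_ker, map_sub, map_mul, map_pow, map_one,
          map_ofNat, e0, e1, e2]
      · ring
      · ring
      · ring
      · linear_combination (-Polynomial.X ^ 2) * h4
    refine ⟨Ideal.Quotient.lift _ e (fun a ha => hle ha), ?_, ?_, ?_⟩
    · exact e0
    · exact e2
    · exact e1
  · intro f g h
    set q : Polynomial ℚ :=
      Polynomial.C (1 / 4 : ℚ) * Polynomial.X ^ 2 + 2 * Polynomial.X with hq
    have hdeg : q.natDegree = 2 := by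
      have : (2 : Polynomial ℚ) = Polynomial.C 2 := rfl
      rw [hq, this]
      compute_degree!
    have hz : ∀ p : Polynomial ℚ, p.comp q = 0 → p = 0 := by
      intro p hp
      rcases Polynomial.comp_eq_zero_iff.mp hp with h | ⟨_, h⟩
      · exact h
      · rw [h, Polynomial.natDegree_C] at hdeg
        omega
    have hg : g = 0 := by
      by_contra hg
      have hgc : g.comp q ≠ 0 := fun h => hg (hz g h)
      have h1 := congrArg Polynomial.natDegree (eq_neg_of_add_eq_zero_left h)
      rw [Polynomial.natDegree_neg, Polynomial.natDegree_X_mul hgc,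
        Polynomial.natDegree_comp, Polynomial.natDegree_comp, hdeg] at h1
      omega
    subst hg
    exact ⟨hz f (by simpa using h), rfl⟩
end
end
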